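/- Let (A,B) be a Katsura pair with B ∈ M_N({0,1}). If the KEP-action (G_B, E_A) is regular, then it is contracting. Moreover, (G_B, E_A) is regular if and only if there is K ∈ ℕ such that: (i) every path μ in E_{A,∞} with A_μ = 1 has length |μ| ≤ K, and (ii) every path μ in E_{A,<∞} with |μ| ≥ K satisfies A_{μ[K,|μ|]} = 1, where μ[K,|μ|] denotes the subpath μ_K μ_{K+1} ⋯ μ_{|μ|}. -/

import Mathlib

open scoped Classical

/-- A Katsura pair on a vertex set `V`: matrices `A` (natural entries) and `B` (integer
entries) with `A i j = 0 → B i j = 0`. -/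
structure KatsuraPair (V : Type) where
  A : V → V → ℕ
  B : V → V → ℤ
  zero : ∀ i j, A i j = 0 → B i j = 0

namespace KatsuraPair

variable {V : Type}

/-- An edge `e_{i,j,m}` (with `0 ≤ m < A i j`) of the graph `E_A`; the range is `i` and the
source is `j`. -/
structure Edge (P : KatsuraPair V) where
  i : V
  j : V
  m : ℕ
  hm : m < P.A i j

variable {P : KatsuraPair V}

/-- A finite path `μ = μ₁⋯μₙ`: consecutive edges satisfy `s(μₜ) = r(μₜ₊₁)`. -/
def IsPath (μ : List (Edge P)) : Prop := μ.Chain' (fun e f => e.j = f.i)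

/-- `r(μ) = v` (vacuously true for the empty path, viewed as a vertex). -/
def rangeIs (μ : List (Edge P)) (v : V) : Prop := ∀ e ∈ μ.head?, e.i = v

/-- The source of a path whose range is `v` (so `s` of the empty path at `v` is `v`). -/
def src (v : V) (μ : List (Edge P)) : V := (μ.getLast?).elim v (fun e => e.j)

/-- `A_μ`, the product of the `A`-entries along `μ` (empty product is 1). -/
def Aprod (μ : List (Edge P)) : ℕ := (μ.map (fun e => P.A e.i e.j)).prod

/-- `B_μ`, the product of the `B`-entries along `μ` (empty product is 1). -/
def Bprod (μ : List (Edge P)) : ℤ := (μ.map (fun e => P.B e.i e.j)).prod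

/-- `a^k · e_{i,j,m} = e_{i,j,m̂}` where `k·B i j + m = k̂·(A i j) + m̂`, `0 ≤ m̂ < A i j`. -/
def edgeAct (k : ℤ) (e : Edge P) : Edge P where
  i := e.i
  j := e.j
  m := ((k * P.B e.i e.j + (e.m : ℤ)) % (P.A e.i e.j : ℤ)).toNat
  hm := by
    have hA : 0 < P.A e.i e.j := Nat.lt_of_le_of_lt (Nat.zero_le _) e.hm
    have hA' : (0 : ℤ) < (P.A e.i e.j : ℤ) := by exact_mod_cast hA
    have h1 : 0 ≤ (k * P.B e.i e.j + (e.m : ℤ)) % (P.A e.i e.j : ℤ) :=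
      Int.emod_nonneg _ hA'.ne'
    have h2 : (k * P.B e.i e.j + (e.m : ℤ)) % (P.A e.i e.j : ℤ) < (P.A e.i e.j : ℤ) :=
      Int.emod_lt_of_pos _ hA'
    omega

/-- `a^k|_{e_{i,j,m}} = a^{k̂}` where `k·B i j + m = k̂·(A i j) + m̂`, `0 ≤ m̂ < A i j`. -/
def edgeRes (k : ℤ) (e : Edge P) : ℤ := (k * P.B e.i e.j + (e.m : ℤ)) / (P.A e.i e.j : ℤ)

/-- The action of `a^k` on finite paths: `a^k · (eν) = (a^k · e)(a^k|_e · ν)`. -/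
def act : ℤ → List (Edge P) → List (Edge P)
  | _, [] => []
  | k, e :: ν => edgeAct k e :: act (edgeRes k e) ν

/-- The restriction along a path: `a^k|_{eν} = (a^k|_e)|_ν`; `res k μ` is the integer with
`a^k|_μ = a^{res k μ}`. -/
def res : ℤ → List (Edge P) → ℤ
  | k, [] => k
  | k, e :: ν => res (edgeRes k e) ν

/-- `a^k` and `a^l` act equally at the vertex `v`. -/
def ActEq (P : KatsuraPair V) (k l : ℤ) (v : V) : Prop :=
  ∀ μ : List (Edge P), IsPath μ → rangeIs μ v → act k μ = act l μ

/-- The KEP-action `(G_B, E_A)` is contracting. -/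
def Contracting (P : KatsuraPair V) : Prop :=
  ∃ F : Finset ℤ, ∀ k : ℤ, ∀ v : V, ∃ n : ℕ, ∀ μ : List (Edge P),
    IsPath μ → rangeIs μ v → n ≤ μ.length →
    ∃ l ∈ F, ActEq P (res k μ) l (src v μ)

/-- The KEP-action `(G_B, E_A)` is regular. -/
def Regular (P : KatsuraPair V) : Prop :=
  ∀ k : ℤ, ∀ v : V, ∃ K : ℕ, ∀ μ : List (Edge P),
    IsPath μ → rangeIs μ v → K ≤ μ.length → act k μ = μ →
    ActEq P (res k μ) 0 (src v μ)

/-- `v ∈ E⁰_{A,<∞}`: the quantity `A_μ / gcd(A_μ, |B_μ|)` is bounded over paths `μ` with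
range `v` and `B_μ ≠ 0`. -/
def FiniteVertex (P : KatsuraPair V) (v : V) : Prop :=
  ∃ C : ℕ, ∀ μ : List (Edge P), IsPath μ → rangeIs μ v → Bprod μ ≠ 0 →
    Aprod μ / Nat.gcd (Aprod μ) (Bprod μ).natAbs ≤ C

/-- An edge of `E_{A,∞}`: `B` nonzero and source in `E⁰_{A,∞}`. -/
def InfEdge (e : Edge P) : Prop := P.B e.i e.j ≠ 0 ∧ ¬ FiniteVertex P e.j

/-- An edge of `E_{A,<∞}`: `B` nonzero and range in `E⁰_{A,<∞}`. -/
def FinEdge (e : Edge P) : Prop := P.B e.i e.j ≠ 0 ∧ FiniteVertex P e.i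

/-- The infinite part `(A_∞, B_∞)` of a Katsura pair. -/
def infinitePart (P : KatsuraPair V) : KatsuraPair {v : V // ¬ FiniteVertex P v} where
  A := fun i j => if P.B i.1 j.1 = 0 then 0 else P.A i.1 j.1
  B := fun i j => P.B i.1 j.1
  zero := fun i j h => by
    by_cases hb : P.B i.1 j.1 = 0
    · exact hb
    · simp only [if_neg hb] at h
      exact P.zero _ _ h

/-- The finite part `(A_{<∞}, B_{<∞})` of a Katsura pair. -/
def finitePart (P : KatsuraPair V) : KatsuraPair {v : V // FiniteVertex P v} where
  A := fun i j => if P.B i.1 j.1 = 0 then 0 else P.A i.1 j.1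
  B := fun i j => P.B i.1 j.1
  zero := fun i j h => by
    by_cases hb : P.B i.1 j.1 = 0
    · exact hb
    · simp only [if_neg hb] at h
      exact P.zero _ _ h

end KatsuraPair

namespace KatsuraPair

section

variable {V : Type} {P : KatsuraPair V}

theorem Edge.A_pos (e : Edge P) : 0 < P.A e.i e.j := Nat.lt_of_le_of_lt (Nat.zero_le _) e.hm

theorem Aprod_cons (e : Edge P) (μ : List (Edge P)) :
    Aprod (e :: μ) = P.A e.i e.j * Aprod μ := by simp [Aprod]

theorem Aprod_append (μ ν : List (Edge P)) : Aprod (μ ++ ν) = Aprod μ * Aprod ν := by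
  simp [Aprod]

theorem Aprod_pos (μ : List (Edge P)) : 0 < Aprod μ := by
  induction μ with
  | nil => simp [Aprod]
  | cons e μ ih => rw [Aprod_cons]; exact Nat.mul_pos e.A_pos ih

theorem isPath_nil : IsPath ([] : List (Edge P)) := List.isChain_nil

theorem isPath_append_right {μ ν : List (Edge P)} (h : IsPath (μ ++ ν)) : IsPath ν :=
  List.IsChain.right_of_append h

theorem isPath_append_left {μ ν : List (Edge P)} (h : IsPath (μ ++ ν)) : IsPath μ :=
  List.IsChain.left_of_append h

theorem isPath_cons_iff {e : Edge P} {μ : List (Edge P)} :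
    IsPath (e :: μ) ↔ rangeIs μ e.j ∧ IsPath μ := by
  refine (List.isChain_cons (R := fun e f : Edge P => e.j = f.i)).trans (and_congr_left' ?_)
  simp only [rangeIs, eq_comm]

theorem src_cons (v : V) (e : Edge P) (μ : List (Edge P)) :
    src v (e :: μ) = src e.j μ := by
  unfold src
  cases μ with
  | nil => simp
  | cons f μ => simp [List.getLast?_eq_some_getLast]

theorem rangeIs_cons_iff {v : V} {e : Edge P} {μ : List (Edge P)} :
    rangeIs (e :: μ) v ↔ e.i = v := by simp [rangeIs]

theorem isPath_append_iff {v : V} {μ ν : List (Edge P)} :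
    IsPath (μ ++ ν) ∧ rangeIs (μ ++ ν) v ↔
      (IsPath μ ∧ rangeIs μ v) ∧ IsPath ν ∧ rangeIs ν (src v μ) := by
  induction μ generalizing v with
  | nil => simp [isPath_nil, rangeIs, src]
  | cons e μ ih =>
    have := ih (v := e.j)
    simp only [List.cons_append, isPath_cons_iff, rangeIs_cons_iff, src_cons]
    tauto

theorem edgeAct_of_B_eq_zero {e : Edge P} (h : P.B e.i e.j = 0) (k : ℤ) : edgeAct k e = e := by
  have := e.hm
  obtain ⟨i, j, m, hm⟩ := e
  simp only at h
  simp only [edgeAct, h, mul_zero, zero_add, Edge.mk.injEq, true_and]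
  rw [Int.emod_eq_of_lt (by omega) (by exact_mod_cast hm)]
  simp

theorem edgeRes_of_B_eq_zero {e : Edge P} (h : P.B e.i e.j = 0) (k : ℤ) : edgeRes k e = 0 := by
  have := e.hm
  simp only [edgeRes, h, mul_zero, zero_add]
  exact Int.ediv_eq_zero_of_lt (by omega) (by exact_mod_cast this)

theorem edgeRes_zero (e : Edge P) : edgeRes 0 e = 0 := by
  have := e.hm
  simp only [edgeRes, zero_mul, zero_add]
  exact Int.ediv_eq_zero_of_lt (by omega) (by exact_mod_cast this)

theorem res_zero (μ : List (Edge P)) : res 0 μ = 0 := by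
  induction μ with
  | nil => rfl
  | cons e μ ih => simp [res, edgeRes_zero, ih]

/-- Restricting along a path through an edge with `B`-entry zero gives the identity. -/
theorem res_eq_zero_of_mem {μ : List (Edge P)} {e : Edge P} (he : e ∈ μ)
    (h : P.B e.i e.j = 0) (k : ℤ) : res k μ = 0 := by
  induction μ generalizing k with
  | nil => simp at he
  | cons f μ ih =>
    rcases List.mem_cons.1 he with rfl | he
    · simp [res, edgeRes_of_B_eq_zero h, res_zero]
    · exact ih he _

/-- A path whose `B`-entries are all `1`, on which the action is an odometer. -/
def IsOdometerPath (μ : List (Edge P)) : Prop := ∀ e ∈ μ, P.B e.i e.j = 1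

theorem isOdometerPath_cons_iff {e : Edge P} {μ : List (Edge P)} :
    IsOdometerPath (e :: μ) ↔ P.B e.i e.j = 1 ∧ IsOdometerPath μ := by
  simp [IsOdometerPath]

theorem isOdometerPath_append_iff {μ ν : List (Edge P)} :
    IsOdometerPath (μ ++ ν) ↔ IsOdometerPath μ ∧ IsOdometerPath ν := by
  simp [IsOdometerPath, or_imp, forall_and]

theorem IsOdometerPath.exists_res_eq {μ : List (Edge P)} (h : IsOdometerPath μ) (k : ℤ) :
    ∃ M : ℤ, 0 ≤ M ∧ M < Aprod μ ∧ res k μ = (k + M) / Aprod μ := by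
  induction μ generalizing k with
  | nil => exact ⟨0, by simp [Aprod, res]⟩
  | cons e μ ih =>
    obtain ⟨hB, hμ⟩ := isOdometerPath_cons_iff.1 h
    obtain ⟨M, h0, h1, h2⟩ := ih hμ (edgeRes k e)
    have hm : (e.m : ℤ) + 1 ≤ P.A e.i e.j := by exact_mod_cast e.hm
    have hA : (0 : ℤ) < P.A e.i e.j := by exact_mod_cast e.A_pos
    refine ⟨e.m + P.A e.i e.j * M, by positivity, ?_, ?_⟩
    · rw [Aprod_cons]; push_cast; nlinarith
    · rw [Aprod_cons]
      push_cast
      rw [← Int.ediv_ediv_of_nonneg hA.le, ← add_assoc, Int.add_mul_ediv_left _ _ hA.ne']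
      simpa [res, edgeRes, hB] using h2

theorem IsOdometerPath.eq_mul_res {μ : List (Edge P)} (h : IsOdometerPath μ) {k : ℤ}
    (hk : act k μ = μ) : k = Aprod μ * res k μ := by
  induction μ generalizing k with
  | nil => simp [Aprod, res]
  | cons e μ ih =>
    obtain ⟨hB, hμ⟩ := isOdometerPath_cons_iff.1 h
    simp only [act, List.cons.injEq] at hk
    have hA : (0 : ℤ) < P.A e.i e.j := by exact_mod_cast e.A_pos
    have h1 := congrArg Edge.m hk.1
    simp only [edgeAct, hB, mul_one] at h1
    have h2 := Int.emod_nonneg (k + e.m) hA.ne'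
    have h3 := Int.mul_ediv_add_emod (k + e.m) (P.A e.i e.j)
    have h4 : edgeRes k e = (k + e.m) / P.A e.i e.j := by simp [edgeRes, hB]
    have h5 : k = P.A e.i e.j * edgeRes k e := by rw [h4]; omega
    have h6 := ih hμ hk.2
    rw [Aprod_cons]
    push_cast
    rw [mul_assoc]
    change _ = _ * (_ * res (edgeRes k e) μ)
    rw [← h6]
    exact h5

theorem IsOdometerPath.act_mul {μ : List (Edge P)} (h : IsOdometerPath μ) (c : ℤ) :
    act (Aprod μ * c) μ = μ ∧ res (Aprod μ * c) μ = c := by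
  induction μ with
  | nil => simp [Aprod, res, act]
  | cons e μ ih =>
    obtain ⟨hB, hμ⟩ := isOdometerPath_cons_iff.1 h
    have hA : (0 : ℤ) < P.A e.i e.j := by exact_mod_cast e.A_pos
    have hm : (e.m : ℤ) < P.A e.i e.j := by exact_mod_cast e.hm
    have h1 : edgeRes (Aprod (e :: μ) * c) e = Aprod μ * c := by
      rw [edgeRes, hB, Aprod_cons]
      push_cast
      rw [mul_one, mul_assoc, add_comm, Int.add_mul_ediv_left _ _ hA.ne',
        Int.ediv_eq_zero_of_lt (by omega) hm, zero_add]
    have h2 : edgeAct (Aprod (e :: μ) * c) e = e := by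
      have h3 : ((Aprod (e :: μ) : ℤ) * c * P.B e.i e.j + e.m) % (P.A e.i e.j : ℤ) = e.m := by
        rw [hB, Aprod_cons]
        push_cast
        rw [mul_one, mul_assoc, add_comm, Int.add_mul_emod_self_left,
          Int.emod_eq_of_lt (by omega) hm]
      unfold edgeAct
      simp [h3]
    simp [act, res, h1, h2, ih hμ]

theorem IsOdometerPath.Bprod_eq_one {μ : List (Edge P)} (h : IsOdometerPath μ) :
    Bprod μ = 1 := by
  induction μ with
  | nil => simp [Bprod]
  | cons e μ ih =>
    obtain ⟨hB, hμ⟩ := isOdometerPath_cons_iff.1 h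
    have := ih hμ
    simp_all [Bprod]

theorem isOdometerPath_of_Bprod_ne_zero (hB : ∀ i j, P.B i j = 0 ∨ P.B i j = 1)
    {μ : List (Edge P)} (h : Bprod μ ≠ 0) : IsOdometerPath μ := by
  intro e he
  refine (hB e.i e.j).resolve_left fun h0 => h ?_
  exact List.prod_eq_zero (List.mem_map.2 ⟨e, he, h0⟩)

theorem finiteVertex_iff (hB : ∀ i j, P.B i j = 0 ∨ P.B i j = 1) {v : V} :
    FiniteVertex P v ↔ ∃ C : ℕ, ∀ μ : List (Edge P), IsPath μ → rangeIs μ v →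
      IsOdometerPath μ → Aprod μ ≤ C := by
  constructor
  · rintro ⟨C, hC⟩
    refine ⟨C, fun μ h1 h2 h3 => ?_⟩
    have := hC μ h1 h2 (by simp [h3.Bprod_eq_one])
    simpa [h3.Bprod_eq_one] using this
  · rintro ⟨C, hC⟩
    refine ⟨C, fun μ h1 h2 h3 => (Nat.div_le_self _ _).trans ?_⟩
    exact hC μ h1 h2 (isOdometerPath_of_Bprod_ne_zero hB h3)

theorem FiniteVertex.source (hB : ∀ i j, P.B i j = 0 ∨ P.B i j = 1) {e : Edge P}
    (h : FiniteVertex P e.i) (he : P.B e.i e.j = 1) : FiniteVertex P e.j := by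
  rw [finiteVertex_iff hB] at h ⊢
  obtain ⟨C, hC⟩ := h
  refine ⟨C, fun μ h1 h2 h3 => le_trans ?_ (hC (e :: μ) (isPath_cons_iff.2 ⟨h2, h1⟩)
    (rangeIs_cons_iff.2 rfl) (isOdometerPath_cons_iff.2 ⟨he, h3⟩))⟩
  rw [Aprod_cons]
  exact Nat.le_mul_of_pos_left _ e.A_pos

theorem FiniteVertex.finEdge_of_mem (hB : ∀ i j, P.B i j = 0 ∨ P.B i j = 1) {v : V}
    (h : FiniteVertex P v) {μ : List (Edge P)} (h1 : IsPath μ) (h2 : rangeIs μ v)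
    (h3 : IsOdometerPath μ) : ∀ e ∈ μ, FinEdge e := by
  induction μ generalizing v with
  | nil => simp
  | cons f μ ih =>
    rw [isPath_cons_iff] at h1
    rw [isOdometerPath_cons_iff] at h3
    obtain rfl := rangeIs_cons_iff.1 h2
    intro e he
    rcases List.mem_cons.1 he with rfl | he
    · exact ⟨by simp [h3.1], h⟩
    · exact ih (h.source hB h3.1) h1.2 h1.1 h3.2 e he

/-- All odometer paths out of `v` have `A_μ = 1`. -/
def Rigid (P : KatsuraPair V) (v : V) : Prop :=
  ∀ μ : List (Edge P), IsPath μ → rangeIs μ v → IsOdometerPath μ → Aprod μ = 1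

theorem Rigid.actEq (hB : ∀ i j, P.B i j = 0 ∨ P.B i j = 1) {v : V} (h : Rigid P v)
    (k l : ℤ) : ActEq P k l v := by
  intro μ h1 h2
  induction μ generalizing v k l with
  | nil => rfl
  | cons e μ ih =>
    obtain rfl := rangeIs_cons_iff.1 h2
    rw [isPath_cons_iff] at h1
    rcases hB e.i e.j with h0 | h0
    · simp [act, edgeAct_of_B_eq_zero h0, edgeRes_of_B_eq_zero h0]
    · have hA : P.A e.i e.j = 1 := by
        simpa [Aprod] using h [e] (List.isChain_singleton e) (rangeIs_cons_iff.2 rfl)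
          (by simp [IsOdometerPath, h0])
      have hr : Rigid P e.j := fun ν n1 n2 n3 => by
        have := h (e :: ν) (isPath_cons_iff.2 ⟨n2, n1⟩) (rangeIs_cons_iff.2 rfl)
          (isOdometerPath_cons_iff.2 ⟨h0, n3⟩)
        rwa [Aprod_cons, hA, one_mul] at this
      have he : edgeAct k e = edgeAct l e := by simp [edgeAct, hA]
      simp only [act, he, ih hr (edgeRes k e) (edgeRes l e) h1.2 h1.1]

theorem rigid_of_actEq_one_zero {v : V} (h : ActEq P 1 0 v) : Rigid P v := by
  intro μ h1 h2 h3
  have h4 := (h3.act_mul 0).1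
  rw [mul_zero, ← h μ h1 h2] at h4
  have h5 := Int.eq_one_or_neg_one_of_mul_eq_one (h3.eq_mul_res h4).symm
  omega

theorem Rigid.finiteVertex (hB : ∀ i j, P.B i j = 0 ∨ P.B i j = 1) {v : V}
    (h : Rigid P v) : FiniteVertex P v :=
  (finiteVertex_iff hB).2 ⟨1, fun μ h1 h2 h3 => (h μ h1 h2 h3).le⟩

theorem two_pow_le_Aprod {K : ℕ}
    (hK : ∀ μ : List (Edge P), IsPath μ → (∀ e ∈ μ, InfEdge e) → Aprod μ = 1 → μ.length ≤ K)
    (n : ℕ) {μ : List (Edge P)} (h1 : IsPath μ) (h2 : ∀ e ∈ μ, InfEdge e)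
    (h3 : (K + 1) * n ≤ μ.length) : 2 ^ n ≤ Aprod μ := by
  induction n generalizing μ with
  | zero => exact Aprod_pos μ
  | succ n ih =>
    have hl : (K + 1) * n + (K + 1) ≤ μ.length := h3
    have hp : IsPath (μ.take (K + 1) ++ μ.drop (K + 1)) := by rwa [List.take_append_drop]
    have ht : Aprod (μ.take (K + 1)) ≠ 1 := fun h => by
      have := hK _ (isPath_append_left hp) (fun e he => h2 e (List.mem_of_mem_take he)) h
      rw [List.length_take] at this
      omega
    have hd := ih (isPath_append_right hp) (fun e he => h2 e (List.mem_of_mem_drop he))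
      (by rw [List.length_drop]; omega)
    have h4 := Aprod_pos (μ.take (K + 1))
    rw [← List.take_append_drop (K + 1) μ, Aprod_append, pow_succ, mul_comm]
    exact Nat.mul_le_mul (by omega) hd

/-- The combinatorial condition characterising regularity, with constant `K`. -/
def BoundedBy (P : KatsuraPair V) (K : ℕ) : Prop :=
  (∀ μ : List (Edge P), IsPath μ → (∀ e ∈ μ, InfEdge e) → Aprod μ = 1 → μ.length ≤ K) ∧
  (∀ μ : List (Edge P), IsPath μ → (∀ e ∈ μ, FinEdge e) → K ≤ μ.length →
    Aprod (μ.drop (K - 1)) = 1)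

theorem BoundedBy.two_pow_le_Aprod_or_rigid (hB : ∀ i j, P.B i j = 0 ∨ P.B i j = 1) {K : ℕ}
    (hK : BoundedBy P K) (n : ℕ) {v : V} {μ : List (Edge P)} (h1 : IsPath μ)
    (h2 : rangeIs μ v) (h3 : IsOdometerPath μ) (h4 : (K + 1) * n + K ≤ μ.length) :
    2 ^ n ≤ Aprod μ ∨ Rigid P (src v μ) := by
  set L := (K + 1) * n
  have hp : IsPath (μ.take L ++ μ.drop L) := by rwa [List.take_append_drop]
  by_cases h : ∀ e ∈ μ.take L, InfEdge e
  · left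
    have := two_pow_le_Aprod hK.1 n (isPath_append_left hp) h (by rw [List.length_take]; omega)
    rw [← List.take_append_drop L μ, Aprod_append]
    exact this.trans (Nat.le_mul_of_pos_right _ (Aprod_pos _))
  · right
    push Not at h
    obtain ⟨e, he, hne⟩ := h
    have he1 : P.B e.i e.j = 1 := h3 e (List.mem_of_mem_take he)
    have hfin : FiniteVertex P e.j := by
      by_contra hf
      exact hne ⟨by simp [he1], hf⟩
    obtain ⟨s, t, hst⟩ := List.append_of_mem he
    have hμ : μ = s ++ e :: (t ++ μ.drop L) := by
      conv_lhs => rw [← List.take_append_drop L μ, hst]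
      simp
    intro ν n1 n2 n3
    have hpath := (isPath_append_iff.2 ⟨⟨h1, h2⟩, n1, n2⟩).1
    have hodo := isOdometerPath_append_iff.2 ⟨h3, n3⟩
    rw [hμ, List.append_assoc, List.cons_append] at hpath hodo
    have hc := isPath_cons_iff.1 (isPath_append_right hpath)
    have hfe := hfin.finEdge_of_mem hB hc.2 hc.1
      (isOdometerPath_cons_iff.1 (isOdometerPath_append_iff.1 hodo).2).2
    have hlen : K ≤ (t ++ μ.drop L).length := by
      rw [List.length_append, List.length_drop]; omega
    have := hK.2 _ hc.2 hfe (by rw [List.length_append]; omega)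
    rw [List.drop_append_of_le_length (by omega), Aprod_append] at this
    exact Nat.eq_one_of_mul_eq_one_left this

theorem BoundedBy.regular (hB : ∀ i j, P.B i j = 0 ∨ P.B i j = 1) {K : ℕ}
    (hK : BoundedBy P K) : Regular P := by
  intro k v
  refine ⟨(K + 1) * k.natAbs + K, fun μ h1 h2 h3 h4 => ?_⟩
  by_cases h : IsOdometerPath μ
  · rcases hK.two_pow_le_Aprod_or_rigid hB k.natAbs h1 h2 h h3 with h5 | h5
    · have h6 := h.eq_mul_res h4
      have h7 : Aprod μ ∣ k.natAbs := Int.natCast_dvd.1 ⟨_, h6⟩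
      have h8 : k.natAbs = 0 := Nat.eq_zero_of_dvd_of_lt h7 (Nat.lt_two_pow_self.trans_le h5)
      rw [Int.natAbs_eq_zero.1 h8, res_zero]
      exact fun _ _ _ => rfl
    · exact h5.actEq hB _ _
  · unfold IsOdometerPath at h
    push Not at h
    obtain ⟨e, he, h0⟩ := h
    rw [res_eq_zero_of_mem he ((hB _ _).resolve_right h0)]
    exact fun _ _ _ => rfl

theorem BoundedBy.contracting (hB : ∀ i j, P.B i j = 0 ∨ P.B i j = 1) {K : ℕ}
    (hK : BoundedBy P K) : Contracting P := by
  refine ⟨{-1, 0, 1}, fun k v => ⟨(K + 1) * k.natAbs + K, fun μ h1 h2 h3 => ?_⟩⟩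
  by_cases h : IsOdometerPath μ
  · rcases hK.two_pow_le_Aprod_or_rigid hB k.natAbs h1 h2 h h3 with h5 | h5
    · have h6 : k.natAbs < Aprod μ := Nat.lt_two_pow_self.trans_le h5
      obtain ⟨M, m0, m1, hr⟩ := h.exists_res_eq k
      have hA : (0 : ℤ) < Aprod μ := by exact_mod_cast Aprod_pos μ
      refine ⟨res k μ, ?_, fun _ _ _ => rfl⟩
      have h7 : -1 ≤ res k μ := by
        rw [hr, Int.le_ediv_iff_mul_le hA]; omega
      have h8 : res k μ < 2 := by
        rw [hr, Int.ediv_lt_iff_lt_mul hA]; omega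
      simp only [Finset.mem_insert, Finset.mem_singleton]
      omega
    · exact ⟨0, by simp, h5.actEq hB _ _⟩
  · unfold IsOdometerPath at h
    push Not at h
    obtain ⟨e, he, h0⟩ := h
    rw [res_eq_zero_of_mem he ((hB _ _).resolve_right h0)]
    exact ⟨0, by simp, fun _ _ _ => rfl⟩

variable [Finite V]

theorem exists_uniform_Aprod_le (hB : ∀ i j, P.B i j = 0 ∨ P.B i j = 1) :
    ∃ C : ℕ, ∀ v, FiniteVertex P v → ∀ μ : List (Edge P), IsPath μ → rangeIs μ v →
      IsOdometerPath μ → Aprod μ ≤ C := by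
  have h : ∀ v, ∃ C : ℕ, FiniteVertex P v → ∀ μ : List (Edge P), IsPath μ → rangeIs μ v →
      IsOdometerPath μ → Aprod μ ≤ C := by
    intro v
    by_cases hv : FiniteVertex P v
    · obtain ⟨C, hC⟩ := (finiteVertex_iff hB).1 hv
      exact ⟨C, fun _ => hC⟩
    · exact ⟨0, fun h => absurd h hv⟩
  choose c hc using h
  obtain ⟨C, hC⟩ := Finite.exists_le c
  exact ⟨C, fun v hv μ h1 h2 h3 => (hc v hv μ h1 h2 h3).trans (hC v)⟩

theorem Regular.exists_uniform (h : Regular P) (C : ℕ) :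
    ∃ K : ℕ, ∀ k : ℕ, k ≤ C → ∀ v, ∀ μ : List (Edge P), IsPath μ → rangeIs μ v →
      K ≤ μ.length → act k μ = μ → ActEq P (res k μ) 0 (src v μ) := by
  choose κ hκ using h
  obtain ⟨K, hK⟩ := Finite.exists_le fun p : Fin (C + 1) × V => κ (p.1 : ℕ) p.2
  refine ⟨K, fun k hk v μ h1 h2 h3 => hκ k v μ h1 h2 (le_trans ?_ h3)⟩
  exact hK (⟨k, by omega⟩, v)

theorem Regular.exists_boundedBy (hB : ∀ i j, P.B i j = 0 ∨ P.B i j = 1) (h : Regular P) :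
    ∃ K, BoundedBy P K := by
  obtain ⟨C, hC⟩ := exists_uniform_Aprod_le hB
  obtain ⟨K, hK⟩ := h.exists_uniform (C + 1)
  have key : ∀ (v : V) (μ : List (Edge P)), IsPath μ → rangeIs μ v → IsOdometerPath μ →
      K ≤ μ.length → Aprod μ ≤ C + 1 → Rigid P (src v μ) := by
    intro v μ h1 h2 h3 h4 h5
    have h6 := h3.act_mul 1
    rw [mul_one] at h6
    have h7 := hK _ h5 v μ h1 h2 h4 h6.1
    rw [h6.2] at h7
    exact rigid_of_actEq_one_zero h7
  refine ⟨K + 1, fun μ h1 h2 h3 => ?_, fun μ h1 h2 h3 => ?_⟩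
  · by_contra hlen
    have hne : μ ≠ [] := by rintro rfl; simp at hlen
    obtain ⟨e, t, rfl⟩ := List.exists_cons_of_ne_nil hne
    have hr := key e.i _ h1 (rangeIs_cons_iff.2 rfl)
      (fun f hf => (hB _ _).resolve_left (h2 f hf).1) (by omega) (by omega)
    have hs : src e.i (e :: t) = ((e :: t).getLast hne).j := by
      rw [src, List.getLast?_eq_some_getLast hne]; rfl
    rw [hs] at hr
    exact (h2 _ (List.getLast_mem hne)).2 (hr.finiteVertex hB)
  · obtain ⟨e, t, rfl⟩ := List.exists_cons_of_ne_nil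
      (show μ ≠ [] by rintro rfl; simp at h3)
    have hodo : IsOdometerPath (e :: t) := fun f hf => (hB _ _).resolve_left (h2 f hf).1
    have hr : rangeIs (e :: t) e.i := rangeIs_cons_iff.2 rfl
    rw [← List.take_append_drop K (e :: t)] at hodo h1 hr
    have hsplit := isPath_append_iff.1 ⟨h1, hr⟩
    have hodo' := isOdometerPath_append_iff.1 hodo
    have hle := hC e.i (h2 e (by simp)).2 _ hsplit.1.1 hsplit.1.2 hodo'.1
    exact key e.i _ hsplit.1.1 hsplit.1.2 hodo'.1 (by rw [List.length_take]; omega) (by omega)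
      _ hsplit.2.1 hsplit.2.2 hodo'.2

end

end KatsuraPair

open KatsuraPair in
/-- for a Katsura pair with `B ∈ M_N({0,1})`: if the KEP-action `(G_B, E_A)`
is regular then it is contracting; moreover it is regular iff there is `K ∈ ℕ` such that
(i) every path `μ` in `E_{A,∞}` with `A_μ = 1` has length `≤ K`, and (ii) every path `μ`
in `E_{A,<∞}` with `|μ| ≥ K` satisfies `A_{μ[K,|μ|]} = 1`. -/
theorem statement11 (N : ℕ) (hN : 0 < N) (P : KatsuraPair (Fin N))
    (hB : ∀ i j, P.B i j = 0 ∨ P.B i j = 1) :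
    (Regular P → Contracting P) ∧
    (Regular P ↔
      ∃ K : ℕ,
        (∀ μ : List (Edge P), IsPath μ → (∀ e ∈ μ, InfEdge e) → Aprod μ = 1 →
          μ.length ≤ K) ∧
        (∀ μ : List (Edge P), IsPath μ → (∀ e ∈ μ, FinEdge e) → K ≤ μ.length →
          Aprod (μ.drop (K - 1)) = 1)) :=
  ⟨fun h => (h.exists_boundedBy hB).elim fun _ hK => hK.contracting hB,
    fun h => h.exists_boundedBy hB, fun ⟨_, hK⟩ => BoundedBy.regular hB hK⟩
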